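/- arXiv:2208.05968 — 6 statements merged into one kernel-verified Lean document; each statement's English description precedes it below -/
import Mathlib

section
/- Let A be a unital subalgebra of ℝ^n and let idem(A) := {f ∈ A : f∧f = f} be its set of idempotent elements. Then idem(A) is a vector σ-algebra, it is the smallest vector σ-algebra F such that every element of A lies in span(F) (in particular span(idem(A)) = A), and the finest resolution res(idem(A)) forms an orthogonal basis of A (for the standard inner product of ℝ^n). -/
open Matrix

noncomputable section

/-- A linear subspace of `ℝ^n` that is closed under the entrywise (Hadamard) product. -/
def IsSubalg {n : ℕ} (A : Submodule ℝ (Fin n → ℝ)) : Prop :=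
  ∀ x ∈ A, ∀ y ∈ A, x * y ∈ A

/-- `alg X`: the smallest subalgebra (for the entrywise product) of `ℝ^n` containing `X`. -/
def algGen {n : ℕ} (X : Set (Fin n → ℝ)) : Submodule ℝ (Fin n → ℝ) :=
  sInf {A : Submodule ℝ (Fin n → ℝ) | IsSubalg A ∧ X ⊆ (A : Set (Fin n → ℝ))}

/-- A vector σ-algebra: a set of {0,1}-vectors containing 𝟘 and 𝟙, closed under
entrywise product `∧`, `∨` and negation. -/
def IsVecSigmaAlg {n : ℕ} (F : Set (Fin n → ℝ)) : Prop :=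
  (∀ f ∈ F, ∀ i, f i = 0 ∨ f i = 1) ∧
  (0 : Fin n → ℝ) ∈ F ∧ (1 : Fin n → ℝ) ∈ F ∧
  (∀ f ∈ F, ∀ g ∈ F, f * g ∈ F) ∧
  (∀ f ∈ F, ∀ g ∈ F, f + g - f * g ∈ F) ∧
  (∀ f ∈ F, 1 - f ∈ F)

/-- `a 1, …, a d` is the finest resolution of the subalgebra `A`: the collection of
nonzero idempotents of `A` with pairwise disjoint supports such that every idempotent
of `A` is a sum of some of them. -/
structure IsFinestRes {n d : ℕ} (A : Submodule ℝ (Fin n → ℝ)) (a : Fin d → Fin n → ℝ) :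
    Prop where
  mem : ∀ j, a j ∈ A
  idem : ∀ j, a j * a j = a j
  ne_zero : ∀ j, a j ≠ 0
  disj : ∀ j k, j ≠ k → a j * a k = 0
  complete : ∀ f ∈ A, f * f = f → ∃ s : Finset (Fin d), f = ∑ j ∈ s, a j

/-- A column-stochastic matrix. -/
def ColStochastic {m n : ℕ} (M : Matrix (Fin m) (Fin n) ℝ) : Prop :=
  (∀ i j, 0 ≤ M i j) ∧ ∀ j, ∑ i, M i j = 1

/-- A probability vector. -/
def IsProbVec {n : ℕ} (p : Fin n → ℝ) : Prop :=
  (∀ i, 0 ≤ p i) ∧ ∑ i, p i = 1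

/-- `E_{|A,p} = Σ_j a_j (p∧a_j)^T / ⟨p,a_j⟩`. -/
def Emat {n d : ℕ} (p : Fin n → ℝ) (a : Fin d → Fin n → ℝ) : Matrix (Fin n) (Fin n) ℝ :=
  Matrix.of fun i k => ∑ j, a j i * (p k * a j k) / (p ⬝ᵥ a j)

/-- `J = Σ_j (p∧a_j) e_j^T / ⟨p,a_j⟩`. -/
def Jmat {n d : ℕ} (p : Fin n → ℝ) (a : Fin d → Fin n → ℝ) : Matrix (Fin n) (Fin d) ℝ :=
  Matrix.of fun i j => p i * a j i / (p ⬝ᵥ a j)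

/-- `R = Σ_j e_j a_j^T`. -/
def Rmat {n d : ℕ} (a : Fin d → Fin n → ℝ) : Matrix (Fin d) (Fin n) ℝ :=
  Matrix.of fun j i => a j i

open Classical in
/-- Indicator vector `𝟙_{supp(W)}` of the support of a subspace `W`. -/
def suppInd {n : ℕ} (W : Submodule ℝ (Fin n → ℝ)) : Fin n → ℝ :=
  fun i => if ∃ x ∈ W, x i ≠ 0 then 1 else 0

/-- `P_C^{y_0…y_k} = P_C^{y_k} ⋯ P_C^{y_1} · diag(e_{y_0}^T C)` where
`P_C^y = diag(e_y^T C) · P`. -/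
def PCseq {n m : ℕ} (P : Matrix (Fin n) (Fin n) ℝ) (C : Matrix (Fin m) (Fin n) ℝ) :
    (k : ℕ) → (Fin (k + 1) → Fin m) → Matrix (Fin n) (Fin n) ℝ
  | 0, y => Matrix.diagonal (C (y 0))
  | k + 1, y =>
      Matrix.diagonal (C (y (Fin.last (k + 1)))) * P * PCseq P C k (fun i => y i.castSucc)

/-- Summation `v ↦ 𝟙^T v` as a linear functional. -/
def sumLin (n : ℕ) : (Fin n → ℝ) →ₗ[ℝ] ℝ where
  toFun v := ∑ i, v i
  map_add' x y := by simp [Finset.sum_add_distrib]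
  map_smul' c x := by simp [Finset.mul_sum]

/-- The non-observable subspace `N = {v : C P^t v = 0 ∀ t}`. -/
def hmmNonObs {n m : ℕ} (P : Matrix (Fin n) (Fin n) ℝ) (C : Matrix (Fin m) (Fin n) ℝ) :
    Submodule ℝ (Fin n → ℝ) :=
  ⨅ t : ℕ, LinearMap.ker (C * P ^ t).mulVecLin

/-- The reachable subspace `R = span{P^t p₀ : t ≥ 0, p₀ ∈ S}`. -/
def hmmReach {n : ℕ} (P : Matrix (Fin n) (Fin n) ℝ) (S : Set (Fin n → ℝ)) :
    Submodule ℝ (Fin n → ℝ) :=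
  Submodule.span ℝ {x | ∃ t : ℕ, ∃ p₀ ∈ S, x = (P ^ t).mulVec p₀}

/-- The conditioned non-observable subspace `N_C`. -/
def condNonObs {n m : ℕ} (P : Matrix (Fin n) (Fin n) ℝ) (C : Matrix (Fin m) (Fin n) ℝ) :
    Submodule ℝ (Fin n → ℝ) :=
  ⨅ (k : ℕ), ⨅ (y : Fin (k + 1) → Fin m),
    LinearMap.ker ((sumLin n).comp (PCseq P C k y).mulVecLin)

/-- The conditioned reachable subspace `R_C`. -/
def condReach {n m : ℕ} (P : Matrix (Fin n) (Fin n) ℝ) (C : Matrix (Fin m) (Fin n) ℝ)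
    (S : Set (Fin n → ℝ)) : Submodule ℝ (Fin n → ℝ) :=
  Submodule.span ℝ
    {x | ∃ (k : ℕ) (y : Fin (k + 1) → Fin m), ∃ p₀ ∈ S, x = (PCseq P C k y).mulVec p₀}

/-- `a 1, …, a d` is the finest resolution of the vector σ-algebra `F`: a partition of 𝟙
made of elements of `F` such that every element of `F` is a {0,1}-combination of them. -/
def IsFinestResOfSigma {n d : ℕ} (F : Set (Fin n → ℝ)) (a : Fin d → Fin n → ℝ) : Prop :=
  (∀ j, a j ∈ F) ∧ (∀ j, a j ≠ 0) ∧ (∀ j k, j ≠ k → a j * a k = 0) ∧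
  (∑ j, a j) = 1 ∧
  (∀ f ∈ F, ∃ c : Fin d → ℝ, (∀ j, c j = 0 ∨ c j = 1) ∧ f = ∑ j, c j • a j)

theorem aux_atoms {n : ℕ} {F : Set (Fin n → ℝ)} (hF : IsVecSigmaAlg F) {f : Fin n → ℝ}
    (hf : f ∈ Submodule.span ℝ F) (hff : ∀ i, f i = 0 ∨ f i = 1) : f ∈ F := by
  classical
  obtain ⟨h01, -, h1, hmul, -, hneg⟩ := hF
  have key : ∀ i k, f i = 1 → f k = 0 → ∃ g ∈ F, g i = 1 ∧ g k = 0 := by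
    intro i k hi hk
    by_contra hcon
    push Not at hcon
    have hE : ∀ g ∈ F, g i = g k := by
      intro g hg
      have h2 := hcon g hg
      have h3 := hcon (1 - g) (hneg g hg)
      simp only [Pi.sub_apply, Pi.one_apply] at h3
      rcases h01 g hg i with hi | hi <;> rcases h01 g hg k with hk | hk <;> simp_all
    have : f i = f k := by
      refine Submodule.span_induction (p := fun x _ => x i = x k) hE ?_ ?_ ?_ hf
      · simp
      · intro x y _ _ hx hy
        simp [hx, hy]
      · intro c x _ hx
        simp [hx]
    rw [hi, hk] at this
    norm_num at this
  choose! g hgF hgi hgk using key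
  have hP : ∀ i, f i = 1 → (∏ k ∈ Finset.univ.filter (fun k => f k = 0), g i k) ∈ F := by
    intro i hi
    refine Finset.prod_induction _ (fun x => x ∈ F) (fun a b ha hb => hmul a ha b hb) h1 ?_
    intro k hk
    exact hgF i k hi (by simpa using hk)
  have hQ : (1 - ∏ i ∈ Finset.univ.filter (fun i => f i = 1),
      (1 - ∏ k ∈ Finset.univ.filter (fun k => f k = 0), g i k)) ∈ F := by
    apply hneg
    refine Finset.prod_induction _ (fun x => x ∈ F) (fun a b ha hb => hmul a ha b hb) h1 ?_
    intro i hi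
    exact hneg _ (hP i (by simpa using hi))
  convert hQ using 1
  funext m
  simp only [Pi.sub_apply, Pi.one_apply, Finset.prod_apply]
  rcases hff m with hm | hm
  · rw [Finset.prod_eq_one, hm, sub_self]
    intro i hi
    rw [Finset.prod_eq_zero (i := m) (by simpa using hm), sub_zero]
    exact hgk i m (by simpa using hi) hm
  · rw [Finset.prod_eq_zero (i := m) (by simpa using hm), hm, sub_zero]
    rw [Finset.prod_eq_one, sub_self]
    intro k hk
    exact hgi m k hm (by simpa using hk)

theorem aux_span {n : ℕ} {A : Submodule ℝ (Fin n → ℝ)} (hA : IsSubalg A)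
    (hA1 : (1 : Fin n → ℝ) ∈ A) {x : Fin n → ℝ} (hx : x ∈ A) :
    x ∈ Submodule.span ℝ {f : Fin n → ℝ | f ∈ A ∧ f * f = f} := by
  classical
  let V := Finset.univ.image x
  let e : ℝ → Fin n → ℝ := fun c => ∏ v ∈ V.erase c, (c - v)⁻¹ • (x - v • (1 : Fin n → ℝ))
  have heA : ∀ c, e c ∈ A := by
    intro c
    refine Finset.prod_induction _ (fun x => x ∈ A) (fun a b ha hb => hA a ha b hb) hA1 ?_
    intro v _
    exact A.smul_mem _ (A.sub_mem hx (A.smul_mem _ hA1))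
  have hev : ∀ c i, e c i = if x i = c then 1 else 0 := by
    intro c i
    simp only [e, Finset.prod_apply, Pi.smul_apply, Pi.sub_apply, Pi.one_apply, smul_eq_mul,
      mul_one]
    split_ifs with h
    · apply Finset.prod_eq_one
      intro v hv
      have : c ≠ v := (Finset.ne_of_mem_erase hv).symm
      rw [h, inv_mul_cancel₀ (sub_ne_zero.2 this)]
    · apply Finset.prod_eq_zero (i := x i)
      · simp [V, h]
      · simp
  have hxe : x = ∑ c ∈ V, c • e c := by
    funext i
    simp [Finset.sum_apply, hev, V]
  rw [hxe]
  refine Submodule.sum_mem _ fun c _ => Submodule.smul_mem _ _ (Submodule.subset_span ⟨heA c, ?_⟩)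
  funext i
  simp [hev]

theorem aux_idem {n : ℕ} {f : Fin n → ℝ} (h : f * f = f) (i : Fin n) : f i = 0 ∨ f i = 1 := by
  have := congrFun h i
  simp only [Pi.mul_apply] at this
  have h2 : f i * (f i - 1) = 0 := by linarith
  rcases mul_eq_zero.1 h2 with h | h
  · exact Or.inl h
  · exact Or.inr (by linarith)

/-- For a unital subalgebra `A` of `ℝ^n`, the set `idem(A)` of its
idempotents is a vector σ-algebra, it is the smallest vector σ-algebra `F` with
`A ⊆ span F` (in particular `span (idem A) = A`), and its finest resolution is an
orthogonal basis of `A`. -/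
theorem idem_of_unital_subalg {n : ℕ} (A : Submodule ℝ (Fin n → ℝ)) (hA : IsSubalg A)
    (hA1 : (1 : Fin n → ℝ) ∈ A) :
    IsVecSigmaAlg {f : Fin n → ℝ | f ∈ A ∧ f * f = f} ∧
    Submodule.span ℝ {f : Fin n → ℝ | f ∈ A ∧ f * f = f} = A ∧
    (∀ F : Set (Fin n → ℝ), IsVecSigmaAlg F →
      (A : Set (Fin n → ℝ)) ⊆ (Submodule.span ℝ F : Set (Fin n → ℝ)) →
      {f : Fin n → ℝ | f ∈ A ∧ f * f = f} ⊆ F) ∧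
    (∀ (d : ℕ) (a : Fin d → Fin n → ℝ),
      IsFinestResOfSigma {f : Fin n → ℝ | f ∈ A ∧ f * f = f} a →
      (∀ j k, j ≠ k → a j ⬝ᵥ a k = 0) ∧ LinearIndependent ℝ a ∧
        Submodule.span ℝ (Set.range a) = A) := by
  have hspan : Submodule.span ℝ {f : Fin n → ℝ | f ∈ A ∧ f * f = f} = A :=
    le_antisymm (Submodule.span_le.2 fun f hf => hf.1) fun x hx => aux_span hA hA1 hx
  refine ⟨⟨fun f hf i => aux_idem hf.2 i, ⟨A.zero_mem, by simp⟩, ⟨hA1, by simp⟩, ?_, ?_, ?_⟩,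
    hspan, ?_, ?_⟩
  · rintro f ⟨hf, hf2⟩ g ⟨hg, hg2⟩
    exact ⟨hA f hf g hg, by rw [mul_mul_mul_comm, hf2, hg2]⟩
  · rintro f ⟨hf, hf2⟩ g ⟨hg, hg2⟩
    refine ⟨A.sub_mem (A.add_mem hf hg) (hA f hf g hg), ?_⟩
    linear_combination (1 - 2 * g + g * g) * hf2 + (1 - f) * hg2
  · rintro f ⟨hf, hf2⟩
    refine ⟨A.sub_mem hA1 hf, ?_⟩
    linear_combination hf2
  · rintro F hF hAF f ⟨hf, hf2⟩
    exact aux_atoms hF (hAF hf) (aux_idem hf2)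
  · rintro d a ⟨hm, hne, hdisj, -, hcomp⟩
    refine ⟨?_, ?_, ?_⟩
    · intro j k hjk
      refine Finset.sum_eq_zero fun i _ => ?_
      exact congrFun (hdisj j k hjk) i
    · rw [Fintype.linearIndependent_iff]
      intro c hc k
      obtain ⟨i, hi⟩ := Function.ne_iff.1 (hne k)
      have h1 := congrFun hc i
      rw [Finset.sum_apply, Finset.sum_eq_single k] at h1
      · simpa [show a k i ≠ 0 from hi] using h1
      · intro j _ hj
        have h2 := congrFun (hdisj j k hj) i
        have h3 : a j i = 0 := by
          rcases mul_eq_zero.1 (show a j i * a k i = 0 from h2) with h | h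
          · exact h
          · exact absurd h hi
        simp [h3]
      · simp
    · apply le_antisymm
      · rw [Submodule.span_le]
        rintro _ ⟨j, rfl⟩
        exact (hm j).1
      · conv_lhs => rw [← hspan]
        rw [Submodule.span_le]
        intro f hf
        obtain ⟨c, -, rfl⟩ := hcomp f hf
        exact Submodule.sum_mem _ fun j _ =>
          Submodule.smul_mem _ _ (Submodule.subset_span ⟨j, rfl⟩)
end
end

section
/- Let A ⊆ ℝ^n be a unital subalgebra with finest resolution {a_1,…,a_d} and let p ∈ ℝ^n be entrywise positive. Define the modified inner products ⟨v,w⟩_p := ⟨p, v∧w⟩ and ⟨v,w⟩_{p^{-1}} := ⟨p^{-1}, v∧w⟩, where p^{-1} is the entrywise inverse of p. Then the matrix E_{|A,p} is the orthogonal projection onto A with respect to ⟨·,·⟩_p, and its transpose E_{|A,p}^T is the orthogonal projection onto p∧A := {p∧a : a ∈ A} with respect to ⟨·,·⟩_{p^{-1}}. -/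
open Matrix

noncomputable section

theorem indicator_mem_aux {n : ℕ} (A : Submodule ℝ (Fin n → ℝ))
    (hA : IsSubalg A) (hA1 : (1 : Fin n → ℝ) ∈ A) (v : Fin n → ℝ) (hv : v ∈ A) (c : ℝ) :
    (fun i => if v i = c then (1 : ℝ) else 0) ∈ A := by
  classical
  let B : Subalgebra ℝ (Fin n → ℝ) := A.toSubalgebra hA1 (fun x y hx hy => hA x hx y hy)
  let S : Finset ℝ := Finset.univ.image v
  by_cases hc : c ∈ S
  · have h : Polynomial.aeval v (Lagrange.basis S id c) ∈ B :=
      Algebra.adjoin_le (Set.singleton_subset_iff.2 (show v ∈ B from hv))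
        (Polynomial.aeval_mem_adjoin_singleton ℝ v)
    have h2 : Polynomial.aeval v (Lagrange.basis S id c)
        = (fun i => if v i = c then (1 : ℝ) else 0) := by
      funext i
      have h3 : (Polynomial.aeval v (Lagrange.basis S id c)) i
          = Polynomial.eval (v i) (Lagrange.basis S id c) := by
        have := Polynomial.aeval_algHom_apply (Pi.evalAlgHom ℝ (fun _ : Fin n => ℝ) i) v
          (Lagrange.basis S id c)
        simpa using this.symm
      rw [h3]
      split_ifs with hi
      · rw [hi]
        exact Lagrange.eval_basis_self (v := id) (Set.injOn_id _) hc
      · exact Lagrange.eval_basis_of_ne (v := id) (Ne.symm hi)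
          (Finset.mem_image_of_mem v (Finset.mem_univ i))
    rw [h2] at h
    exact h
  · have : (fun i => if v i = c then (1 : ℝ) else 0) = 0 := by
      funext i
      have : v i ≠ c := fun h => hc (h ▸ Finset.mem_image_of_mem v (Finset.mem_univ i))
      simp [this]
    rw [this]
    exact A.zero_mem

theorem mem_span_aux {n d : ℕ} (A : Submodule ℝ (Fin n → ℝ))
    (hA : IsSubalg A) (hA1 : (1 : Fin n → ℝ) ∈ A)
    (a : Fin d → Fin n → ℝ) (ha : IsFinestRes A a) (v : Fin n → ℝ) (hv : v ∈ A) :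
    v ∈ Submodule.span ℝ (Set.range a) := by
  classical
  have h : v = ∑ c ∈ Finset.univ.image v, c • (fun i => if v i = c then (1 : ℝ) else 0) := by
    funext i
    simp [Finset.sum_apply]
  rw [h]
  refine Submodule.sum_mem _ fun c _ => Submodule.smul_mem _ _ ?_
  obtain ⟨s, hs⟩ := ha.complete _ (indicator_mem_aux A hA hA1 v hv c) (by
    funext i; simp)
  rw [hs]
  exact Submodule.sum_mem _ fun j _ => Submodule.subset_span ⟨j, rfl⟩

theorem Emat_mulVec_aux {n d : ℕ} (p : Fin n → ℝ) (a : Fin d → Fin n → ℝ) (x : Fin n → ℝ) :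
    (Emat p a).mulVec x = ∑ j, ((p ⬝ᵥ (a j * x)) / (p ⬝ᵥ a j)) • a j := by
  funext i
  simp only [Emat, Matrix.mulVec, dotProduct, Matrix.of_apply, Finset.sum_apply, Pi.smul_apply,
    smul_eq_mul, Pi.mul_apply, Finset.sum_mul, Finset.sum_div]
  rw [Finset.sum_comm]
  refine Finset.sum_congr rfl fun j _ => Finset.sum_congr rfl fun k _ => ?_
  ring

theorem Emat_transpose_aux {n d : ℕ} (p : Fin n → ℝ) (hp : ∀ i, 0 < p i)
    (a : Fin d → Fin n → ℝ) (x : Fin n → ℝ) :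
    (Emat p a)ᵀ.mulVec x = p * (Emat p a).mulVec (p⁻¹ * x) := by
  funext i
  simp only [Emat, Matrix.mulVec, dotProduct, Matrix.of_apply, Matrix.transpose_apply,
    Pi.mul_apply, Pi.inv_apply, Finset.mul_sum, Finset.sum_mul]
  refine Finset.sum_congr rfl fun k _ => Finset.sum_congr rfl fun j _ => ?_
  have := (hp k).ne'
  have e : p i * (a j i * (p k * a j k) / (∑ i, p i * a j i) * ((p k)⁻¹ * x k))
    = p i * (a j i * a j k / (∑ i, p i * a j i) * x k) * (p k * (p k)⁻¹) := by ring
  rw [e, mul_inv_cancel₀ this]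
  ring

theorem pos_aux {n d : ℕ} (A : Submodule ℝ (Fin n → ℝ))
    (a : Fin d → Fin n → ℝ) (ha : IsFinestRes A a)
    (p : Fin n → ℝ) (hp : ∀ i, 0 < p i) (j : Fin d) : p ⬝ᵥ a j ≠ 0 := by
  have h0 : ∀ i, 0 ≤ a j i := fun i => by
    have := congrFun (ha.idem j) i
    rw [← this]
    exact mul_self_nonneg _
  intro h
  apply ha.ne_zero j
  funext i
  have h1 := (Finset.sum_eq_zero_iff_of_nonneg
    (fun i _ => mul_nonneg (hp i).le (h0 i))).1 h i (Finset.mem_univ i)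
  exact (mul_eq_zero.1 h1).resolve_left (hp i).ne'

theorem Emat_self_aux {n d : ℕ} (A : Submodule ℝ (Fin n → ℝ))
    (a : Fin d → Fin n → ℝ) (ha : IsFinestRes A a)
    (p : Fin n → ℝ) (hp : ∀ i, 0 < p i) (k : Fin d) : (Emat p a).mulVec (a k) = a k := by
  rw [Emat_mulVec_aux, Finset.sum_eq_single k]
  · rw [ha.idem, div_self (pos_aux A a ha p hp k), one_smul]
  · intro j _ hj
    rw [ha.disj j k hj]
    simp
  · simp

theorem Emat_symm_aux {n d : ℕ} (p : Fin n → ℝ) (a : Fin d → Fin n → ℝ) (x y : Fin n → ℝ) :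
    p ⬝ᵥ ((Emat p a).mulVec x * y) = p ⬝ᵥ (x * (Emat p a).mulVec y) := by
  have key : ∀ x y : Fin n → ℝ, p ⬝ᵥ ((Emat p a).mulVec x * y)
      = ∑ j, (p ⬝ᵥ (a j * x)) * (p ⬝ᵥ (a j * y)) / (p ⬝ᵥ a j) := by
    intro x y
    rw [Emat_mulVec_aux, Finset.sum_mul, dotProduct_sum]
    refine Finset.sum_congr rfl fun j _ => ?_
    rw [smul_mul_assoc, dotProduct_smul, smul_eq_mul]
    ring
  rw [key, mul_comm x, key]
  refine Finset.sum_congr rfl fun j _ => ?_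
  ring

/-- For a unital subalgebra `A` with finest resolution `a` and an
entrywise positive `p`, the matrix `E_{|A,p}` is the orthogonal projection onto `A` for
the inner product `⟨v,w⟩_p = ⟨p, v∧w⟩`, and its transpose is the orthogonal projection
onto `p∧A` for the inner product `⟨v,w⟩_{p⁻¹} = ⟨p⁻¹, v∧w⟩`. -/
theorem Emat_is_orthogonal_projection {n d : ℕ} (A : Submodule ℝ (Fin n → ℝ))
    (hA : IsSubalg A) (hA1 : (1 : Fin n → ℝ) ∈ A)
    (a : Fin d → Fin n → ℝ) (ha : IsFinestRes A a)
    (p : Fin n → ℝ) (hp : ∀ i, 0 < p i) :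
    (∀ x : Fin n → ℝ, (Emat p a).mulVec x ∈ A) ∧
    (∀ v ∈ A, (Emat p a).mulVec v = v) ∧
    (∀ x : Fin n → ℝ, ∀ v ∈ A, p ⬝ᵥ ((x - (Emat p a).mulVec x) * v) = 0) ∧
    (∀ x : Fin n → ℝ, ∃ v ∈ A, (Emat p a)ᵀ.mulVec x = p * v) ∧
    (∀ v ∈ A, (Emat p a)ᵀ.mulVec (p * v) = p * v) ∧
    (∀ x : Fin n → ℝ, ∀ v ∈ A, p⁻¹ ⬝ᵥ ((x - (Emat p a)ᵀ.mulVec x) * (p * v)) = 0) := by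
  have h1 : ∀ x : Fin n → ℝ, (Emat p a).mulVec x ∈ A := fun x => by
    rw [Emat_mulVec_aux]
    exact A.sum_mem fun j _ => A.smul_mem _ (ha.mem j)
  have h2 : ∀ v ∈ A, (Emat p a).mulVec v = v := fun v hv => by
    have := mem_span_aux A hA hA1 a ha v hv
    induction this using Submodule.span_induction with
    | mem x hx =>
      obtain ⟨k, rfl⟩ := hx
      exact Emat_self_aux A a ha p hp k
    | zero => simp
    | add x y hx hy ihx ihy =>
      have hs : Submodule.span ℝ (Set.range a) ≤ A :=
        Submodule.span_le.2 (by rintro _ ⟨j, rfl⟩; exact ha.mem j)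
      rw [Matrix.mulVec_add, ihx (hs hx), ihy (hs hy)]
    | smul c x hx ih =>
      have hs : Submodule.span ℝ (Set.range a) ≤ A :=
        Submodule.span_le.2 (by rintro _ ⟨j, rfl⟩; exact ha.mem j)
      rw [Matrix.mulVec_smul, ih (hs hx)]
  have h3 : ∀ x : Fin n → ℝ, ∀ v ∈ A, p ⬝ᵥ ((x - (Emat p a).mulVec x) * v) = 0 := by
    intro x v hv
    rw [sub_mul, dotProduct_sub, Emat_symm_aux, h2 v hv, sub_self]
  have hpi : p⁻¹ * p = 1 := by
    funext i
    exact inv_mul_cancel₀ (hp i).ne'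
  refine ⟨h1, h2, h3, ?_, ?_, ?_⟩
  · intro x
    exact ⟨_, h1 (p⁻¹ * x), Emat_transpose_aux p hp a x⟩
  · intro v hv
    rw [Emat_transpose_aux p hp, ← mul_assoc, hpi, one_mul, h2 v hv]
  · intro x v hv
    rw [Emat_transpose_aux p hp, ← h3 (p⁻¹ * x) v hv]
    refine Finset.sum_congr rfl fun i _ => ?_
    have := (hp i).ne'
    simp only [Pi.mul_apply, Pi.sub_apply, Pi.inv_apply]
    field_simp

end
end

section
/- Let A ⊆ ℝ^n be a unital subalgebra with finest resolution {a_1,…,a_d} and let p ∈ ℝ^n be entrywise positive. Then the factors J ∈ ℝ^{n×d} and R ∈ ℝ^{d×n} are column-stochastic matrices satisfying J·R = E_{|A,p}^T, R·J = I_d, ker(R) = A^⊥ and ker(J^T) = (p∧A)^⊥, where the orthogonal complements are taken with respect to the standard inner product and p∧A := {p∧a : a ∈ A}. -/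
open Matrix

noncomputable section

theorem aux_mul_sum {n d : ℕ} {A : Submodule ℝ (Fin n → ℝ)}
    {a : Fin d → Fin n → ℝ} (ha : IsFinestRes A a) (s : Finset (Fin d)) (k : Fin d) :
    (∑ j ∈ s, a j) * a k = if k ∈ s then a k else 0 := by
  rw [Finset.sum_mul, ← Finset.sum_ite_eq s k (fun _ => a k)]
  refine Finset.sum_congr rfl fun j _ => ?_
  split_ifs with h
  · subst h
    exact ha.idem _
  · exact ha.disj _ _ (Ne.symm h)

theorem aux_ind_mem {n : ℕ} {A : Submodule ℝ (Fin n → ℝ)}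
    (hA : IsSubalg A) (hA1 : (1 : Fin n → ℝ) ∈ A) (v : Fin n → ℝ) (hv : v ∈ A) (i₀ : Fin n) :
    (fun i => if v i = v i₀ then (1 : ℝ) else 0) ∈ A := by
  have key : ∀ t : Finset (Fin n),
      (fun i => ∏ k ∈ t, (if v k = v i₀ then (1 : ℝ) else (v i - v k) / (v i₀ - v k))) ∈ A := by
    intro t
    induction t using Finset.induction_on with
    | empty =>
      simp only [Finset.prod_empty]
      exact hA1
    | insert k t hk ih =>
      simp only [Finset.prod_insert hk]
      refine hA (fun i => if v k = v i₀ then (1 : ℝ) else (v i - v k) / (v i₀ - v k)) ?_ _ ih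
      by_cases h : v k = v i₀
      · simp only [h, if_true]
        exact hA1
      · simp only [h, if_false]
        have := A.smul_mem (v i₀ - v k)⁻¹ (A.sub_mem hv (A.smul_mem (v k) hA1))
        convert this using 1
        ext i
        simp [div_eq_inv_mul]
  convert key Finset.univ using 1
  ext i
  split_ifs with h
  · symm
    refine Finset.prod_eq_one fun k _ => ?_
    split_ifs with h'
    · rfl
    · rw [h]
      exact div_self (sub_ne_zero.2 (Ne.symm h'))
  · symm
    refine Finset.prod_eq_zero (Finset.mem_univ i) ?_
    simp [h]

theorem aux_span_s3 {n d : ℕ} {A : Submodule ℝ (Fin n → ℝ)}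
    (hA : IsSubalg A) (hA1 : (1 : Fin n → ℝ) ∈ A)
    {a : Fin d → Fin n → ℝ} (ha : IsFinestRes A a) (v : Fin n → ℝ) (hv : v ∈ A)
    (j : Fin d) : ∃ c : ℝ, v * a j = c • a j := by
  obtain ⟨i₀, hi₀⟩ : ∃ i, a j i ≠ 0 := Function.ne_iff.1 (ha.ne_zero j)
  refine ⟨v i₀, ?_⟩
  obtain ⟨s, hs⟩ := ha.complete _ (aux_ind_mem hA hA1 v hv i₀) (by ext i; simp)
  have h := aux_mul_sum ha s j
  rw [← hs] at h
  have hj : j ∈ s := by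
    by_contra hj
    have := congrFun h i₀
    simp [hj] at this
    exact hi₀ this
  rw [if_pos hj] at h
  ext i
  have := congrFun h i
  simp only [Pi.mul_apply, Pi.smul_apply, smul_eq_mul] at this ⊢
  by_cases hi : v i = v i₀
  · rw [hi]
  · simp [hi] at this
    simp [← this]

/-- For a unital subalgebra `A` with finest resolution `a` and an
entrywise positive `p`, the factors `J` and `R` are column-stochastic and satisfy
`J·R = E_{|A,p}ᵀ`, `R·J = I_d`, `ker R = A^⊥` and `ker Jᵀ = (p∧A)^⊥` (orthogonal
complements for the standard inner product). -/
theorem stochastic_factors_of_Emat {n d : ℕ} (A : Submodule ℝ (Fin n → ℝ))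
    (hA : IsSubalg A) (hA1 : (1 : Fin n → ℝ) ∈ A)
    (a : Fin d → Fin n → ℝ) (ha : IsFinestRes A a)
    (p : Fin n → ℝ) (hp : ∀ i, 0 < p i) :
    ColStochastic (Jmat p a) ∧
    ColStochastic (Rmat a) ∧
    Jmat p a * Rmat a = (Emat p a)ᵀ ∧
    Rmat a * Jmat p a = 1 ∧
    (∀ x : Fin n → ℝ, (Rmat a).mulVec x = 0 ↔ ∀ v ∈ A, x ⬝ᵥ v = 0) ∧
    (∀ x : Fin n → ℝ, (Jmat p a)ᵀ.mulVec x = 0 ↔ ∀ v ∈ A, x ⬝ᵥ (p * v) = 0) := by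
  have h01 : ∀ j i, a j i = 0 ∨ a j i = 1 := by
    intro j i
    have h := congrFun (ha.idem j) i
    simp only [Pi.mul_apply] at h
    rcases eq_or_ne (a j i) 0 with h0 | h0
    · exact Or.inl h0
    · exact Or.inr (mul_left_cancel₀ h0 (by rw [h, mul_one]))
  have hnn : ∀ j i, 0 ≤ a j i := by
    intro j i
    rcases h01 j i with h | h <;> simp [h]
  have hone : ∑ j, a j = 1 := by
    obtain ⟨s, hs⟩ := ha.complete 1 hA1 (by simp)
    have : s = Finset.univ := by
      refine Finset.eq_univ_iff_forall.2 fun k => ?_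
      by_contra hk
      have h := aux_mul_sum ha s k
      rw [← hs, if_neg hk, one_mul] at h
      exact ha.ne_zero k h
    rw [hs, this]
  have hpos : ∀ j, 0 < p ⬝ᵥ a j := by
    intro j
    obtain ⟨i, hi⟩ : ∃ i, a j i ≠ 0 := Function.ne_iff.1 (ha.ne_zero j)
    refine Finset.sum_pos' (fun i _ => mul_nonneg (hp i).le (hnn j i)) ⟨i, Finset.mem_univ _, ?_⟩
    exact mul_pos (hp i) (lt_of_le_of_ne (hnn j i) (Ne.symm hi))
  have hdec : ∀ v ∈ A, ∃ c : Fin d → ℝ, v = ∑ j, c j • a j := by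
    intro v hv
    choose c hc using aux_span_s3 hA hA1 ha v hv
    refine ⟨c, ?_⟩
    rw [← Finset.sum_congr rfl (fun j _ => hc j), ← Finset.mul_sum, hone, mul_one]
  refine ⟨⟨?_, ?_⟩, ⟨?_, ?_⟩, ?_, ?_, ?_, ?_⟩
  · intro i j
    exact div_nonneg (mul_nonneg (hp i).le (hnn j i)) (hpos j).le
  · intro j
    simp only [Jmat, Matrix.of_apply]
    rw [← Finset.sum_div]
    exact div_self (hpos j).ne'
  · intro j i
    exact hnn j i
  · intro i
    have := congrFun hone i
    simpa [Rmat] using this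
  · ext i k
    simp only [Jmat, Rmat, Emat, Matrix.mul_apply, Matrix.of_apply, Matrix.transpose_apply]
    refine Finset.sum_congr rfl fun j _ => ?_
    ring
  · ext j k
    simp only [Jmat, Rmat, Matrix.mul_apply, Matrix.of_apply, Matrix.one_apply]
    have e : ∀ i, a j i * (p i * a k i / (p ⬝ᵥ a k)) = p i * ((a j * a k) i) / (p ⬝ᵥ a k) := by
      intro i
      simp only [Pi.mul_apply]
      ring
    simp only [e]
    split_ifs with h
    · subst h
      rw [ha.idem, ← Finset.sum_div]
      exact div_self (hpos j).ne'
    · rw [ha.disj j k h]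
      simp
  · intro x
    have e : ∀ j, (Rmat a).mulVec x j = x ⬝ᵥ a j := fun j => dotProduct_comm _ _
    constructor
    · intro h v hv
      obtain ⟨c, rfl⟩ := hdec v hv
      rw [dotProduct_sum]
      refine Finset.sum_eq_zero fun j _ => ?_
      rw [dotProduct_smul, ← e, h]
      simp
    · intro h
      ext j
      rw [e]
      exact h _ (ha.mem j)
  · intro x
    have e : ∀ j, (Jmat p a)ᵀ.mulVec x j = (x ⬝ᵥ (p * a j)) / (p ⬝ᵥ a j) := by
      intro j
      simp only [Matrix.mulVec, Jmat, dotProduct, Matrix.transpose_apply, Matrix.of_apply,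
        Pi.mul_apply]
      rw [Finset.sum_div]
      refine Finset.sum_congr rfl fun i _ => ?_
      ring
    constructor
    · intro h v hv
      obtain ⟨c, rfl⟩ := hdec v hv
      rw [Finset.mul_sum, dotProduct_sum]
      refine Finset.sum_eq_zero fun j _ => ?_
      have h2 := e j
      rw [h, Pi.zero_apply, eq_comm, div_eq_zero_iff, or_iff_left (hpos j).ne'] at h2
      rw [mul_smul_comm, dotProduct_smul, h2, smul_zero]
    · intro h
      ext j
      rw [e, h _ (ha.mem j)]
      simp

end
end

section
/- Let (P, C) be an HMM with finite set S of initial probability vectors, P ∈ ℝ^{n×n}. Then sequences of length at most n suffice to compute the conditioned subspaces: N_C = {v ∈ ℝ^n : 𝟙^T P_C^{y_0…y_l} v = 0 for all sequences y_0,…,y_l with l < n} and R_C = span{P_C^{y_0…y_l} p₀ : p₀ ∈ S, all sequences y_0,…,y_l with l < n}. -/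
open Matrix

noncomputable section

theorem chain_aux {V ι : Type*} [AddCommGroup V] [Module ℝ V] [FiniteDimensional ℝ V]
    (T : ι → V →ₗ[ℝ] V) (gen : ℕ → Set V)
    (h1 : ∀ k i x, x ∈ gen k → T i x ∈ gen (k + 1))
    (h2 : ∀ k x, x ∈ gen (k + 1) → ∃ i, ∃ x' ∈ gen k, x = T i x') (j : ℕ) (x : V)
    (hx : x ∈ gen j) :
    x ∈ Submodule.span ℝ {x | ∃ l, l < Module.finrank ℝ V ∧ x ∈ gen l} := by
  let U : ℕ → Submodule ℝ V := fun k => Submodule.span ℝ {x | ∃ l, l < k ∧ x ∈ gen l}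
  have hmono : Monotone U := fun a b hab =>
    Submodule.span_mono fun x ⟨l, hl, hx⟩ => ⟨l, lt_of_lt_of_le hl hab, hx⟩
  have hT : ∀ k i x, x ∈ U k → T i x ∈ U (k + 1) := by
    intro k i
    have : U k ≤ (U (k + 1)).comap (T i) := by
      refine Submodule.span_le.2 ?_
      rintro x ⟨l, hl, hx⟩
      exact Submodule.subset_span ⟨l + 1, by omega, h1 l i x hx⟩
    exact fun x hx => this hx
  have hex : ∃ k ≤ Module.finrank ℝ V, U (k + 1) ≤ U k := by
    by_contra! hcon
    have : ∀ k ≤ Module.finrank ℝ V + 1, k ≤ Module.finrank ℝ (U k) := by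
      intro k
      induction k with
      | zero => intro _; exact Nat.zero_le _
      | succ k ih =>
        intro hk
        have hlt : U k < U (k + 1) :=
          lt_of_le_not_ge (hmono (Nat.le_succ k)) (hcon k (by omega))
        have := Submodule.finrank_lt_finrank_of_lt hlt
        have := ih (by omega)
        omega
    have h := this _ le_rfl
    have := Submodule.finrank_le (U (Module.finrank ℝ V + 1))
    omega
  obtain ⟨k, hk, hle⟩ := hex
  have key : ∀ j x, x ∈ gen j → x ∈ U k := by
    intro j
    induction j with
    | zero =>
      intro x hx
      exact hle (Submodule.subset_span ⟨0, by omega, hx⟩)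
    | succ j ih =>
      intro x hx
      obtain ⟨i, x', hx', rfl⟩ := h2 j x hx
      exact hle (hT k i x' (ih x' hx'))
  exact hmono hk (key j x hx)

theorem PCseq_tail {n m : ℕ} (P : Matrix (Fin n) (Fin n) ℝ) (C : Matrix (Fin m) (Fin n) ℝ)
    (k : ℕ) (y : Fin (k + 2) → Fin m) :
    PCseq P C (k + 1) y =
      PCseq P C k (fun i => y i.succ) * (P * Matrix.diagonal (C (y 0))) := by
  induction k with
  | zero => simp [PCseq, Matrix.mul_assoc]
  | succ k ih =>
    rw [PCseq, ih, PCseq]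
    simp only [Matrix.mul_assoc]
    rfl

theorem reach_aux {n m : ℕ} (P : Matrix (Fin n) (Fin n) ℝ) (C : Matrix (Fin m) (Fin n) ℝ)
    (S : Set (Fin n → ℝ)) : condReach P C S = Submodule.span ℝ
      {x | ∃ l : ℕ, l < n ∧ ∃ y : Fin (l + 1) → Fin m, ∃ p₀ ∈ S,
        x = (PCseq P C l y).mulVec p₀} := by
  apply le_antisymm
  · refine Submodule.span_le.2 ?_
    rintro x ⟨k, y, p, hp, hx⟩
    have := chain_aux (fun i : Fin m => (Matrix.diagonal (C i) * P).mulVecLin)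
      (fun l => {x | ∃ y : Fin (l + 1) → Fin m, ∃ p₀ ∈ S, x = (PCseq P C l y).mulVec p₀})
      (by
        rintro k i x ⟨y, p, hp, rfl⟩
        refine ⟨Fin.snoc (α := fun _ => Fin m) y i, p, hp, ?_⟩
        simp [PCseq, Matrix.mul_assoc])
      (by
        rintro k x ⟨y, p, hp, rfl⟩
        refine ⟨y (Fin.last (k + 1)), _, ⟨fun i => y i.castSucc, p, hp, rfl⟩, ?_⟩
        simp [PCseq, Matrix.mul_assoc])
      k x ⟨y, p, hp, hx⟩
    simpa using this
  · refine Submodule.span_mono ?_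
    rintro x ⟨l, -, y, p, hp, hx⟩
    exact ⟨l, y, p, hp, hx⟩

theorem obs_aux {n m : ℕ} (P : Matrix (Fin n) (Fin n) ℝ) (C : Matrix (Fin m) (Fin n) ℝ)
    (k : ℕ) (y : Fin (k + 1) → Fin m) :
    (1 : Fin n → ℝ) ᵥ* PCseq P C k y ∈ Submodule.span ℝ
      {x | ∃ l : ℕ, l < n ∧ ∃ y : Fin (l + 1) → Fin m,
        x = (1 : Fin n → ℝ) ᵥ* PCseq P C l y} := by
  have := chain_aux (fun i : Fin m => (P * Matrix.diagonal (C i)).vecMulLinear)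
      (fun l => {x | ∃ y : Fin (l + 1) → Fin m, x = (1 : Fin n → ℝ) ᵥ* PCseq P C l y})
      (by
        rintro k i x ⟨y, rfl⟩
        refine ⟨Fin.cons (α := fun _ => Fin m) i y, ?_⟩
        rw [PCseq_tail, ← Matrix.vecMul_vecMul]
        simp)
      (by
        rintro k x ⟨y, rfl⟩
        refine ⟨y 0, _, ⟨fun i => y i.succ, rfl⟩, ?_⟩
        rw [PCseq_tail, ← Matrix.vecMul_vecMul]
        simp)
      k _ ⟨y, rfl⟩
  simpa using this

/-- (Cayley–Hamilton-like property.) Sequences `y_0,…,y_l` of length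
`l < n` suffice to compute the conditioned non-observable and reachable subspaces. -/
theorem conditioned_subspaces_finite_sequences {n m : ℕ}
    (P : Matrix (Fin n) (Fin n) ℝ) (C : Matrix (Fin m) (Fin n) ℝ)
    (hP : ColStochastic P) (hC : ColStochastic C)
    (S : Set (Fin n → ℝ)) (hSfin : S.Finite) (hS : ∀ p₀ ∈ S, IsProbVec p₀) :
    (∀ v : Fin n → ℝ, v ∈ condNonObs P C ↔
      ∀ l : ℕ, l < n → ∀ y : Fin (l + 1) → Fin m,
        (1 : Fin n → ℝ) ⬝ᵥ (PCseq P C l y).mulVec v = 0) ∧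
    condReach P C S = Submodule.span ℝ
      {x | ∃ l : ℕ, l < n ∧ ∃ y : Fin (l + 1) → Fin m, ∃ p₀ ∈ S,
        x = (PCseq P C l y).mulVec p₀} := by
  refine ⟨fun v => ?_, reach_aux P C S⟩
  have hmem : v ∈ condNonObs P C ↔ ∀ (l : ℕ) (y : Fin (l + 1) → Fin m),
      (1 : Fin n → ℝ) ⬝ᵥ (PCseq P C l y).mulVec v = 0 := by
    simp [condNonObs, Submodule.mem_iInf, sumLin, one_dotProduct]
  rw [hmem]
  refine ⟨fun h l _ y => h l y, fun h k y => ?_⟩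
  rw [Matrix.dotProduct_mulVec]
  refine Submodule.span_induction (p := fun w _ => w ⬝ᵥ v = 0) ?_ ?_ ?_ ?_ (obs_aux P C k y)
  · rintro x ⟨l, hl, y, rfl⟩
    rw [← Matrix.dotProduct_mulVec]
    exact h l hl y
  · simp
  · intro a b _ _ ha hb
    rw [add_dotProduct, ha, hb, add_zero]
  · intro c a _ ha
    rw [smul_dotProduct, ha, smul_zero]

end
end

section
/- Let (P, C) be an HMM with finite set S of initial probability vectors. Then ker(C) ⊇ N ⊇ N_C and span(S) ⊆ R ⊆ R_C, where N, R are the non-observable and reachable subspaces and N_C, R_C are their conditioned counterparts. -/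
open Matrix

noncomputable section

theorem sum_diag_C {n m : ℕ} (C : Matrix (Fin m) (Fin n) ℝ) (hC : ColStochastic C) :
    ∑ z, Matrix.diagonal (C z) = (1 : Matrix (Fin n) (Fin n) ℝ) := by
  ext i j
  rw [Matrix.sum_apply]
  by_cases h : i = j
  · subst h
    simpa using hC.2 i
  · simp [h]

theorem diag_pow_mem {n m : ℕ} (P : Matrix (Fin n) (Fin n) ℝ) (C : Matrix (Fin m) (Fin n) ℝ)
    (hC : ColStochastic C) (k : ℕ) : ∀ z : Fin m,
    Matrix.diagonal (C z) * P ^ k ∈ Submodule.span ℝ (Set.range (PCseq P C k)) := by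
  induction k with
  | zero =>
    intro z
    refine Submodule.subset_span ⟨fun _ => z, ?_⟩
    simp [PCseq]
  | succ k ih =>
    intro z
    have h1 : P ^ k ∈ Submodule.span ℝ (Set.range (PCseq P C k)) := by
      have h2 := Submodule.sum_mem _ (fun z (_ : z ∈ Finset.univ) => ih z)
      rwa [← Finset.sum_mul, sum_diag_C C hC, one_mul] at h2
    rw [pow_succ', ← mul_assoc]
    have h3 : Submodule.span ℝ (Set.range (PCseq P C k)) ≤
        (Submodule.span ℝ (Set.range (PCseq P C (k + 1)))).comap
          (LinearMap.mulLeft ℝ (Matrix.diagonal (C z) * P)) := by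
      rw [Submodule.span_le]
      rintro _ ⟨y, rfl⟩
      refine Submodule.subset_span ⟨Fin.snoc (α := fun _ => Fin m) y z, ?_⟩
      simp [PCseq, mul_assoc]
    exact h3 h1

theorem pow_mem_span_PCseq {n m : ℕ} (P : Matrix (Fin n) (Fin n) ℝ)
    (C : Matrix (Fin m) (Fin n) ℝ) (hC : ColStochastic C) (k : ℕ) :
    P ^ k ∈ Submodule.span ℝ (Set.range (PCseq P C k)) := by
  have h2 := Submodule.sum_mem _ (fun z (_ : z ∈ Finset.univ) => diag_pow_mem P C hC k z)
  rwa [← Finset.sum_mul, sum_diag_C C hC, one_mul] at h2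

/-- Inclusions `ker C ⊇ N ⊇ N_C` and `span S ⊆ R ⊆ R_C`. -/
theorem subspace_inclusions {n m : ℕ}
    (P : Matrix (Fin n) (Fin n) ℝ) (C : Matrix (Fin m) (Fin n) ℝ)
    (hP : ColStochastic P) (hC : ColStochastic C)
    (S : Set (Fin n → ℝ)) (hSfin : S.Finite) (hS : ∀ p₀ ∈ S, IsProbVec p₀) :
    (∀ v ∈ hmmNonObs P C, C.mulVec v = 0) ∧
    (condNonObs P C ≤ hmmNonObs P C) ∧
    (Submodule.span ℝ S ≤ hmmReach P S) ∧
    (hmmReach P S ≤ condReach P C S) := by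
  refine ⟨?_, ?_, ?_, ?_⟩
  · intro v hv
    have h := (Submodule.mem_iInf _).1 hv 0
    simpa using h
  · intro v hv
    refine (Submodule.mem_iInf _).2 fun t => ?_
    rw [LinearMap.mem_ker, Matrix.mulVecLin_apply]
    ext z
    have h3 : Submodule.span ℝ (Set.range (PCseq P C t)) ≤
        LinearMap.ker ((sumLin n).comp ((Matrix.mulVecBilin ℝ ℝ).flip v)) := by
      rw [Submodule.span_le]
      rintro _ ⟨y, rfl⟩
      have h := (Submodule.mem_iInf _).1 ((Submodule.mem_iInf _).1 hv t) y
      exact h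
    have h4 := h3 (diag_pow_mem P C hC t z)
    have h5 : ∑ i, ((Matrix.diagonal (C z) * P ^ t).mulVec v) i = 0 := h4
    rw [← Matrix.mulVec_mulVec] at h5 ⊢
    simp only [Matrix.mulVec_diagonal] at h5
    exact h5
  · refine Submodule.span_mono fun p hp => ⟨0, p, hp, by simp⟩
  · refine Submodule.span_le.2 ?_
    rintro _ ⟨t, p, hp, rfl⟩
    have h3 : Submodule.span ℝ (Set.range (PCseq P C t)) ≤
        (condReach P C S).comap ((Matrix.mulVecBilin ℝ ℝ).flip p) := by
      rw [Submodule.span_le]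
      rintro _ ⟨y, rfl⟩
      exact Submodule.subset_span ⟨t, y, p, hp, rfl⟩
    exact h3 (pow_mem_span_PCseq P C hC t)

end
end

section
/- Let A ⊆ ℝ^n be a subalgebra with finest resolution {a_1,…,a_d}, let p ∈ ℝ^n be entrywise positive, and let c ∈ ℝ^n be such that A is invariant under the map v ↦ c∧v. Let J, R be the factors of E_{|A,p}^T. Then R·diag(c) = diag(J^T c)·R. In particular, for an HMM (P, C) this gives R·diag(e_i^T C) = diag(e_i^T C J)·R for every i whenever A is diag(e_i^T C)-invariant. -/
open Matrix

noncomputable section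

theorem prod_mem_aux {n : ℕ} (A : Submodule ℝ (Fin n → ℝ)) (c : Fin n → ℝ)
    (hc : ∀ v ∈ A, c * v ∈ A) (v : Fin n → ℝ) (hv : v ∈ A) (i : Fin n)
    (T : Finset (Fin n)) :
    (fun x => (∏ l ∈ T, (c x - c l) / (c i - c l)) * v x) ∈ A := by
  classical
  induction T using Finset.induction_on with
  | empty => simpa using hv
  | insert l T hl ih =>
    have h1 := A.smul_mem (c i - c l)⁻¹ (A.sub_mem (hc _ ih) (A.smul_mem (c l) ih))
    convert h1 using 1
    funext x
    rw [Finset.prod_insert hl]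
    simp only [Pi.smul_apply, Pi.sub_apply, Pi.mul_apply, smul_eq_mul]
    ring

theorem idem_zero_one {n d : ℕ} {A : Submodule ℝ (Fin n → ℝ)}
    {a : Fin d → Fin n → ℝ} (ha : IsFinestRes A a) (j : Fin d) (x : Fin n) :
    a j x = 0 ∨ a j x = 1 := by
  have h : a j x * a j x = a j x := congrFun (ha.idem j) x
  rcases eq_or_ne (a j x) 0 with h0 | h0
  · exact Or.inl h0
  · exact Or.inr (mul_left_cancel₀ h0 (by rw [h, mul_one]))

theorem const_on_supp {n d : ℕ} (A : Submodule ℝ (Fin n → ℝ))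
    (a : Fin d → Fin n → ℝ) (ha : IsFinestRes A a)
    (c : Fin n → ℝ) (hc : ∀ v ∈ A, c * v ∈ A) (j : Fin d) (i k : Fin n)
    (hi : a j i ≠ 0) (hk : a j k ≠ 0) : c k = c i := by
  classical
  by_contra hne
  set T : Finset (Fin n) := Finset.univ.filter (fun l => c l ≠ c i) with hT
  have hone : ∀ x, c x = c i → (∏ l ∈ T, (c x - c l) / (c i - c l)) = 1 := by
    intro x hx
    apply Finset.prod_eq_one
    intro l hl
    have hl' : c l ≠ c i := by simpa [hT] using hl
    rw [hx, div_self (sub_ne_zero.mpr hl'.symm)]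
  have hzero : ∀ x, c x ≠ c i → (∏ l ∈ T, (c x - c l) / (c i - c l)) = 0 := by
    intro x hx
    exact Finset.prod_eq_zero (i := x) (by simpa [hT] using hx) (by simp)
  have hmem := prod_mem_aux A c hc (a j) (ha.mem j) i T
  obtain ⟨s, hs⟩ := ha.complete _ hmem (by
    funext x
    have h : a j x * a j x = a j x := congrFun (ha.idem j) x
    by_cases hx : c x = c i
    · simp only [Pi.mul_apply, hone x hx, one_mul, h]
    · simp only [Pi.mul_apply, hzero x hx, zero_mul])
  have hother : ∀ x, a j x ≠ 0 → ∀ l, l ≠ j → a l x = 0 := by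
    intro x hx l hl
    have h : a l x * a j x = 0 := congrFun (ha.disj l j hl) x
    exact (mul_eq_zero.mp h).resolve_right hx
  have hsi := congrFun hs i
  have hsk := congrFun hs k
  simp only [hone i rfl, one_mul, Finset.sum_apply] at hsi
  simp only [hzero k hne, zero_mul, Finset.sum_apply] at hsk
  by_cases hj : j ∈ s
  · rw [Finset.sum_eq_single_of_mem j hj (fun l _ hl => hother k hk l hl)] at hsk
    exact hk hsk.symm
  · apply hi
    rw [hsi]
    apply Finset.sum_eq_zero
    intro l hl
    exact hother i hi l (fun h => hj (h ▸ hl))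

theorem switch_aux {n d : ℕ} (A : Submodule ℝ (Fin n → ℝ))
    (a : Fin d → Fin n → ℝ) (ha : IsFinestRes A a)
    (p : Fin n → ℝ) (hp : ∀ i, 0 < p i)
    (c : Fin n → ℝ) (hc : ∀ v ∈ A, c * v ∈ A) :
    Rmat a * Matrix.diagonal c =
      Matrix.diagonal (Matrix.vecMul c (Jmat p a)) * Rmat a := by
  ext j x
  rw [Matrix.mul_diagonal, Matrix.diagonal_mul]
  simp only [Rmat, Jmat, Matrix.of_apply, Matrix.vecMul, dotProduct]
  by_cases hx : a j x = 0
  · simp [hx]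
  have hpos : 0 < ∑ k, p k * a j k := by
    apply Finset.sum_pos'
    · intro k _
      rcases idem_zero_one ha j k with h | h <;> simp [h, (hp k).le]
    · refine ⟨x, Finset.mem_univ _, ?_⟩
      rw [(idem_zero_one ha j x).resolve_left hx, mul_one]
      exact hp x
  have hsum : ∀ D : ℝ, ∑ k, c k * (p k * a j k / D) = c x * ((∑ k, p k * a j k) / D) := by
    intro D
    rw [Finset.sum_div, Finset.mul_sum]
    apply Finset.sum_congr rfl
    intro k _
    by_cases hk : a j k = 0
    · simp [hk]
    · rw [const_on_supp A a ha c hc j x k hx hk]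
  rw [hsum, div_self hpos.ne', mul_one, mul_comm]

/-- If the subalgebra `A` (with finest resolution `a`) is invariant
under `v ↦ c∧v`, then `R·diag(c) = diag(Jᵀc)·R`; in particular, for an HMM `(P,C)`,
`R·diag(e_iᵀC) = diag(e_iᵀCJ)·R` whenever `A` is `diag(e_iᵀC)`-invariant. -/
theorem Rmat_diag_switch {n m d : ℕ} (A : Submodule ℝ (Fin n → ℝ)) (hA : IsSubalg A)
    (a : Fin d → Fin n → ℝ) (ha : IsFinestRes A a)
    (p : Fin n → ℝ) (hp : ∀ i, 0 < p i)
    (c : Fin n → ℝ) (hc : ∀ v ∈ A, c * v ∈ A) :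
    (Rmat a * Matrix.diagonal c =
      Matrix.diagonal (Matrix.vecMul c (Jmat p a)) * Rmat a) ∧
    (∀ (P : Matrix (Fin n) (Fin n) ℝ) (C : Matrix (Fin m) (Fin n) ℝ),
      ColStochastic P → ColStochastic C →
      ∀ i : Fin m, (∀ v ∈ A, C i * v ∈ A) →
        Rmat a * Matrix.diagonal (C i) =
          Matrix.diagonal (Matrix.vecMul (C i) (Jmat p a)) * Rmat a) := by
  exact ⟨switch_aux A a ha p hp c hc,
    fun _ C _ _ i hi => switch_aux A a ha p hp (C i) hi⟩

end
end
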